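/- arXiv:2404.06018 — 2 statements merged into one kernel-verified Lean document; each statement's English description precedes it below -/
import Mathlib

section
/- Let A ∈ ℝ^{m×n} have rows a_1, …, a_m, all nonzero, let x* ∈ ℝⁿ and b = Ax*, let α ∈ (0, 2), and let λ ≥ 0 be such that every nonzero eigenvalue of AᵀA is at least λ. Define the Kaczmarz update maps F_i(x) = x − α((a_iᵀx − b_i)/‖a_i‖₂²) a_i and the probabilities p_i = ‖a_i‖₂²/‖A‖_F². Then for every x⁰ with x⁰ − x* ∈ range(Aᵀ) and every k ≥ 0, the expected squared error after k random steps satisfies ∑_{(i_1,…,i_k) ∈ {1,…,m}^k} (∏_{j=1}^k p_{i_j}) ‖(F_{i_k} ∘ ⋯ ∘ F_{i_1})(x⁰) − x*‖₂² ≤ (1 − α(2 − α)λ/‖A‖_F²)^k ‖x⁰ − x*‖₂². -/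
open Matrix

theorem Matrix.IsHermitian.sum_dotProduct_eigenvectorBasis {n : ℕ} {M : Matrix (Fin n) (Fin n) ℝ}
    (hM : M.IsHermitian) (u v : Fin n → ℝ) :
    ∑ j, (u ⬝ᵥ (hM.eigenvectorBasis j).ofLp) * (v ⬝ᵥ (hM.eigenvectorBasis j).ofLp) = u ⬝ᵥ v := by
  have h := hM.eigenvectorBasis.sum_inner_mul_inner (WithLp.toLp 2 u) (WithLp.toLp 2 v)
  simp only [EuclideanSpace.inner_eq_star_dotProduct, star_trivial] at h
  rw [dotProduct_comm u v, ← h]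
  exact Finset.sum_congr rfl fun j _ => by rw [dotProduct_comm u]

theorem le_mulVec_dotProduct_self_of_mem_range_transpose {m n : ℕ} (A : Matrix (Fin m) (Fin n) ℝ)
    (lam : ℝ) (hlam : ∀ μ ∈ spectrum ℝ (Aᵀ * A), μ ≠ 0 → lam ≤ μ) (y : Fin m → ℝ) :
    lam * ((Aᵀ *ᵥ y) ⬝ᵥ (Aᵀ *ᵥ y)) ≤ (A *ᵥ (Aᵀ *ᵥ y)) ⬝ᵥ (A *ᵥ (Aᵀ *ᵥ y)) := by
  have hM : (Aᵀ * A).IsHermitian := by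
    simpa [conjTranspose_eq_transpose_of_trivial] using isHermitian_conjTranspose_mul_self A
  set e := Aᵀ *ᵥ y with he
  have hAe : (A *ᵥ e) ⬝ᵥ (A *ᵥ e) = ((Aᵀ * A) *ᵥ e) ⬝ᵥ e := by
    rw [← mulVec_mulVec, mulVec_transpose, ← dotProduct_mulVec]
  rw [hAe, ← hM.sum_dotProduct_eigenvectorBasis e e,
    ← hM.sum_dotProduct_eigenvectorBasis _ e, Finset.mul_sum]
  refine Finset.sum_le_sum fun j _ => ?_
  set w := (hM.eigenvectorBasis j).ofLp with hw
  have hMw : (Aᵀ * A) *ᵥ w = hM.eigenvalues j • w := hM.mulVec_eigenvectorBasis j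
  have hinner : ((Aᵀ * A) *ᵥ e) ⬝ᵥ w = hM.eigenvalues j * (e ⬝ᵥ w) := by
    rw [← smul_eq_mul, ← dotProduct_smul, ← hMw, dotProduct_mulVec, ← mulVec_transpose,
      transpose_mul, transpose_transpose]
  rw [hinner]
  rcases eq_or_ne (hM.eigenvalues j) 0 with h0 | h0
  · have hAw : A *ᵥ w = 0 := by
      rw [← dotProduct_self_eq_zero, dotProduct_mulVec, ← mulVec_transpose, mulVec_mulVec, hMw, h0,
        zero_smul, zero_dotProduct]
    have hew : e ⬝ᵥ w = 0 := by
      rw [he, mulVec_transpose, ← dotProduct_mulVec, hAw, dotProduct_zero]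
    simp [hew]
  · have := hlam _ (hM.eigenvalues_mem_spectrum_real j) h0
    rw [mul_assoc]
    exact mul_le_mul_of_nonneg_right this (mul_self_nonneg _)

theorem dotProduct_self_sub_relaxed_projection {n : ℕ} (a e : Fin n → ℝ) (ha : a ≠ 0) (α : ℝ) :
    (a ⬝ᵥ a) * ((e - (α * ((a ⬝ᵥ e) / (a ⬝ᵥ a))) • a) ⬝ᵥ (e - (α * ((a ⬝ᵥ e) / (a ⬝ᵥ a))) • a)) =
      (a ⬝ᵥ a) * (e ⬝ᵥ e) - α * (2 - α) * ((a ⬝ᵥ e) * (a ⬝ᵥ e)) := by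
  have h : a ⬝ᵥ a ≠ 0 := fun h => ha (dotProduct_self_eq_zero.mp h)
  simp only [sub_dotProduct, dotProduct_sub, smul_dotProduct, dotProduct_smul, smul_eq_mul,
    dotProduct_comm e a]
  field_simp
  ring

theorem kaczmarz_expected_error_step {m n : ℕ} (A : Matrix (Fin m) (Fin n) ℝ)
    (hA : ∀ i, A i ≠ 0) (α : ℝ) (hα0 : 0 < α) (hα2 : α < 2) (lam : ℝ)
    (hlam : ∀ μ ∈ spectrum ℝ (Aᵀ * A), μ ≠ 0 → lam ≤ μ)
    (e : Fin n → ℝ) (he : ∃ y, e = Aᵀ *ᵥ y) :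
    ∑ i, (A i ⬝ᵥ A i) / (∑ i, A i ⬝ᵥ A i) *
        ((e - (α * ((A i ⬝ᵥ e) / (A i ⬝ᵥ A i))) • A i) ⬝ᵥ
          (e - (α * ((A i ⬝ᵥ e) / (A i ⬝ᵥ A i))) • A i)) ≤
      (1 - α * (2 - α) * lam / (∑ i, A i ⬝ᵥ A i)) * (e ⬝ᵥ e) := by
  obtain ⟨y, rfl⟩ := he
  rcases isEmpty_or_nonempty (Fin m) with hm | hm
  · have : Aᵀ *ᵥ y = 0 := by ext; simp [mulVec, dotProduct]
    simp [this]
  have hspec := le_mulVec_dotProduct_self_of_mem_range_transpose A lam hlam y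
  set e := Aᵀ *ᵥ y
  have hS : 0 < ∑ i, A i ⬝ᵥ A i := Finset.sum_pos (fun i _ =>
    lt_of_le_of_ne (Finset.sum_nonneg fun _ _ => mul_self_nonneg _)
      fun h => hA i (dotProduct_self_eq_zero.mp h.symm)) Finset.univ_nonempty
  simp only [div_mul_eq_mul_div _ (∑ i, A i ⬝ᵥ A i), dotProduct_self_sub_relaxed_projection _ _ (hA _)]
  rw [← Finset.sum_div, Finset.sum_sub_distrib, ← Finset.sum_mul, ← Finset.mul_sum,
    div_le_iff₀ hS]
  have hAe : ∑ i, (A i ⬝ᵥ e) * (A i ⬝ᵥ e) = (A *ᵥ e) ⬝ᵥ (A *ᵥ e) := rfl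
  rw [hAe]
  have := mul_le_mul_of_nonneg_left hspec (mul_nonneg hα0.le (sub_nonneg.mpr hα2.le))
  field_simp
  linarith

theorem stmt_14 {m n : ℕ} (A : Matrix (Fin m) (Fin n) ℝ) (hA : ∀ i, A i ≠ 0)
    (xs : Fin n → ℝ) (b : Fin m → ℝ) (hb : b = A.mulVec xs)
    (α : ℝ) (hα0 : 0 < α) (hα2 : α < 2)
    (lam : ℝ) (hlam0 : 0 ≤ lam)
    (hlam : ∀ μ ∈ spectrum ℝ (Aᵀ * A), μ ≠ 0 → lam ≤ μ)
    (x0 : Fin n → ℝ) (hx0 : ∃ y, x0 - xs = Aᵀ.mulVec y) :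
    ∀ k : ℕ,
      ∑ s : Fin k → Fin m,
          (∏ j, (A (s j) ⬝ᵥ A (s j)) / (∑ i : Fin m, A i ⬝ᵥ A i)) *
            (((List.ofFn s).foldl
                (fun x i => x - (α * ((A i ⬝ᵥ x - b i) / (A i ⬝ᵥ A i))) • A i) x0 - xs) ⬝ᵥ
              ((List.ofFn s).foldl
                (fun x i => x - (α * ((A i ⬝ᵥ x - b i) / (A i ⬝ᵥ A i))) • A i) x0 - xs)) ≤
        (1 - α * (2 - α) * lam / (∑ i : Fin m, A i ⬝ᵥ A i)) ^ k *
          ((x0 - xs) ⬝ᵥ (x0 - xs)) := by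
  intro k
  have hcontract := kaczmarz_expected_error_step A hA α hα0 hα2 lam hlam
  generalize 1 - α * (2 - α) * lam / (∑ i, A i ⬝ᵥ A i) = ρ at hcontract ⊢
  induction k generalizing x0 with
  | zero => simp
  | succ k ih =>
    have hstep := hcontract (x0 - xs) hx0
    have herr (i : Fin m) : x0 - (α * ((A i ⬝ᵥ x0 - b i) / (A i ⬝ᵥ A i))) • A i - xs =
        (x0 - xs) - (α * ((A i ⬝ᵥ (x0 - xs)) / (A i ⬝ᵥ A i))) • A i := by
      have hbi : b i = A i ⬝ᵥ xs := congrFun hb i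
      rw [hbi, dotProduct_sub, sub_right_comm]
    have hweight (i : Fin m) : 0 ≤ (A i ⬝ᵥ A i) / (∑ i, A i ⬝ᵥ A i) :=
      div_nonneg (Finset.sum_nonneg fun _ _ => mul_self_nonneg _)
        (Finset.sum_nonneg fun _ _ => Finset.sum_nonneg fun _ _ => mul_self_nonneg _)
    have hrange (i : Fin m) :
        ∃ y, x0 - (α * ((A i ⬝ᵥ x0 - b i) / (A i ⬝ᵥ A i))) • A i - xs = Aᵀ *ᵥ y := by
      obtain ⟨y, hy⟩ := hx0
      refine ⟨y - (α * ((A i ⬝ᵥ (x0 - xs)) / (A i ⬝ᵥ A i))) • Pi.single i 1, ?_⟩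
      rw [herr, mulVec_sub, mulVec_smul, mulVec_single_one, ← hy]
      rfl
    rw [← (Fin.consEquiv fun _ => Fin m).sum_comp, Fintype.sum_prod_type]
    simp only [Fin.consEquiv_apply, Fin.prod_univ_succ, Fin.cons_zero, Fin.cons_succ,
      List.ofFn_succ, List.foldl_cons, mul_assoc, ← Finset.mul_sum]
    refine (Finset.sum_le_sum fun i _ =>
      mul_le_mul_of_nonneg_left (ih _ (hrange i)) (hweight i)).trans ?_
    simp only [herr, mul_left_comm _ (_ ^ k) _]
    rw [← Finset.mul_sum, pow_succ, mul_assoc (ρ ^ k)]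
    rcases eq_or_ne (x0 - xs) 0 with h0 | h0
    · simp [h0]
    · have hpos : 0 < (x0 - xs) ⬝ᵥ (x0 - xs) :=
        lt_of_le_of_ne (Finset.sum_nonneg fun _ _ => mul_self_nonneg _)
          fun h => h0 (dotProduct_self_eq_zero.mp h.symm)
      have hρ := nonneg_of_mul_nonneg_left ((Finset.sum_nonneg fun i _ => mul_nonneg (hweight i)
        (Finset.sum_nonneg fun _ _ => mul_self_nonneg _)).trans hstep) hpos
      exact mul_le_mul_of_nonneg_left hstep (pow_nonneg hρ k)
end

section
/- Let a_1, …, a_m ∈ ℝⁿ be nonzero; let p be a probability distribution on the subsets J ⊆ {1,…,m}; let w_1, …, w_m be weights with 0 ≤ w_i ≤ w_max; for each J set M_J = ∑_{i∈J} w_i a_i a_iᵀ/‖a_i‖₂², and define W = ∑_J p(J) ∑_{i∈J} a_i a_iᵀ/‖a_i‖₂². If Λ > 0 is such that for every J with p(J) > 0 every eigenvalue of ∑_{i∈J} a_i a_iᵀ/‖a_i‖₂² is at most Λ, then ∑_J p(J) M_J² ⪯ w_max² Λ · W in the Loewner order. -/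
open Matrix

theorem mulVec_sum_smul_vecMulVec_self {ι n : Type*} [Fintype n] (s : Finset ι) (c : ι → ℝ)
    (a : ι → n → ℝ) (x : n → ℝ) :
    (∑ i ∈ s, c i • vecMulVec (a i) (a i)) *ᵥ x = ∑ i ∈ s, (c i * (a i ⬝ᵥ x)) • a i := by
  rw [Matrix.sum_mulVec]
  refine Finset.sum_congr rfl fun i _ => ?_
  rw [Matrix.smul_mulVec, vecMulVec_mulVec]
  ext j
  simp
  ring

theorem dotProduct_sum_smul_vecMulVec_self_mulVec {ι n : Type*} [Fintype n] (s : Finset ι)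
    (c : ι → ℝ) (a : ι → n → ℝ) (x y : n → ℝ) :
    y ⬝ᵥ (∑ i ∈ s, c i • vecMulVec (a i) (a i)) *ᵥ x =
      ∑ i ∈ s, c i * (a i ⬝ᵥ x) * (a i ⬝ᵥ y) := by
  rw [mulVec_sum_smul_vecMulVec_self, dotProduct_sum]
  refine Finset.sum_congr rfl fun i _ => ?_
  rw [dotProduct_smul, dotProduct_comm y, smul_eq_mul]

theorem isHermitian_sum_smul_vecMulVec_self {ι n : Type*} (s : Finset ι) (c : ι → ℝ)
    (a : ι → n → ℝ) : (∑ i ∈ s, c i • vecMulVec (a i) (a i)).IsHermitian := by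
  rw [IsHermitian, conjTranspose_eq_transpose_of_trivial, transpose_sum]
  refine Finset.sum_congr rfl fun i _ => ?_
  rw [transpose_smul, transpose_vecMulVec]

theorem Matrix.IsHermitian.dotProduct_mulVec_le_of_spectrum_le {n : Type*} [Fintype n]
    [DecidableEq n] {S : Matrix n n ℝ} (hS : S.IsHermitian) {Λ : ℝ}
    (hΛ : ∀ μ ∈ spectrum ℝ S, μ ≤ Λ) (y : n → ℝ) : y ⬝ᵥ S *ᵥ y ≤ Λ * (y ⬝ᵥ y) := by
  have hpos : (algebraMap ℝ (Matrix n n ℝ) Λ - S).PosSemidef := by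
    rw [posSemidef_iff_isHermitian_and_spectrum_nonneg]
    refine ⟨IsHermitian.sub ?_ hS, ?_⟩
    · rw [algebraMap_eq_diagonal]
      exact isHermitian_diagonal _
    · rw [← spectrum.singleton_sub_eq]
      rintro _ ⟨_, rfl, μ, hμ, rfl⟩
      exact sub_nonneg.2 (hΛ μ hμ)
  have h := hpos.dotProduct_mulVec_nonneg y
  rw [star_trivial, sub_mulVec, dotProduct_sub, Algebra.algebraMap_eq_smul_one, smul_mulVec,
    one_mulVec, dotProduct_smul, smul_eq_mul] at h
  linarith

/-- Squaring a weighted sum of rank one matrices costs at most the factor `wmax ^ 2 * Λ`, when the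
quadratic form of the unweighted sum is bounded by `Λ`. -/
theorem dotProduct_sq_sum_smul_vecMulVec_self_le {ι n : Type*} [Fintype n] (s : Finset ι)
    {c w : ι → ℝ} (hc : ∀ i, 0 ≤ c i) {wmax : ℝ} (hw : ∀ i, 0 ≤ w i ∧ w i ≤ wmax)
    (a : ι → n → ℝ) {Λ : ℝ} (hΛ0 : 0 ≤ Λ)
    (hΛ : ∀ y, y ⬝ᵥ (∑ i ∈ s, c i • vecMulVec (a i) (a i)) *ᵥ y ≤ Λ * (y ⬝ᵥ y)) (x : n → ℝ) :
    x ⬝ᵥ ((∑ i ∈ s, (w i * c i) • vecMulVec (a i) (a i)) *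
        (∑ i ∈ s, (w i * c i) • vecMulVec (a i) (a i))) *ᵥ x ≤
      wmax ^ 2 * Λ * (x ⬝ᵥ (∑ i ∈ s, c i • vecMulVec (a i) (a i)) *ᵥ x) := by
  set M := ∑ i ∈ s, (w i * c i) • vecMulVec (a i) (a i) with hM
  set y := M *ᵥ x
  have hsymm : x ⬝ᵥ (M * M) *ᵥ x = y ⬝ᵥ y := by
    have hMt : Mᵀ = M := isHermitian_sum_smul_vecMulVec_self s _ a
    rw [← mulVec_mulVec, dotProduct_mulVec, ← mulVec_transpose, hMt]
  have hyy : y ⬝ᵥ y = ∑ i ∈ s, (w i * √(c i) * (a i ⬝ᵥ x)) * (√(c i) * (a i ⬝ᵥ y)) := by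
    rw [show y ⬝ᵥ y = y ⬝ᵥ M *ᵥ x from rfl, hM, dotProduct_sum_smul_vecMulVec_self_mulVec]
    refine Finset.sum_congr rfl fun i _ => ?_
    linear_combination -(w i * (a i ⬝ᵥ x) * (a i ⬝ᵥ y)) * Real.mul_self_sqrt (hc i)
  have hCS := Finset.sum_mul_sq_le_sq_mul_sq s
    (fun i => w i * √(c i) * (a i ⬝ᵥ x)) (fun i => √(c i) * (a i ⬝ᵥ y))
  have hx : ∑ i ∈ s, (w i * √(c i) * (a i ⬝ᵥ x)) ^ 2 ≤
      wmax ^ 2 * (x ⬝ᵥ (∑ i ∈ s, c i • vecMulVec (a i) (a i)) *ᵥ x) := by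
    rw [dotProduct_sum_smul_vecMulVec_self_mulVec, Finset.mul_sum]
    refine Finset.sum_le_sum fun i _ => ?_
    have h := mul_le_mul_of_nonneg_right (pow_le_pow_left₀ (hw i).1 (hw i).2 2)
      (mul_nonneg (hc i) (sq_nonneg (a i ⬝ᵥ x)))
    rw [mul_pow, mul_pow, Real.sq_sqrt (hc i)]
    linarith
  have hy' : ∑ i ∈ s, (√(c i) * (a i ⬝ᵥ y)) ^ 2 ≤ Λ * (y ⬝ᵥ y) := by
    refine le_trans (le_of_eq ?_) (hΛ y)
    rw [dotProduct_sum_smul_vecMulVec_self_mulVec]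
    refine Finset.sum_congr rfl fun i _ => ?_
    rw [mul_pow, Real.sq_sqrt (hc i)]
    ring
  have hQ : 0 ≤ wmax ^ 2 * (x ⬝ᵥ (∑ i ∈ s, c i • vecMulVec (a i) (a i)) *ᵥ x) :=
    (Finset.sum_nonneg fun i _ => sq_nonneg _).trans hx
  rw [← hyy] at hCS
  have h := hCS.trans (mul_le_mul hx hy' (Finset.sum_nonneg fun i _ => sq_nonneg _) hQ)
  rw [hsymm]
  rcases (show 0 ≤ y ⬝ᵥ y from Finset.sum_nonneg fun i _ => mul_self_nonneg _).eq_or_lt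
    with h0 | h0
  · rw [← h0]
    linarith [mul_nonneg hΛ0 hQ]
  · refine le_of_mul_le_mul_right ?_ h0
    linarith

theorem stmt_18 {m n : ℕ} (a : Fin m → Fin n → ℝ) (ha : ∀ i, a i ≠ 0)
    (p : Finset (Fin m) → ℝ) (hp : ∀ J, 0 ≤ p J) (hp1 : ∑ J : Finset (Fin m), p J = 1)
    (w : Fin m → ℝ) (wmax : ℝ) (hw : ∀ i, 0 ≤ w i ∧ w i ≤ wmax)
    (Λ : ℝ) (hΛ0 : 0 < Λ)
    (hΛ : ∀ J : Finset (Fin m), 0 < p J →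
      ∀ μ ∈ spectrum ℝ (∑ i ∈ J, (1 / (a i ⬝ᵥ a i)) • Matrix.vecMulVec (a i) (a i)), μ ≤ Λ) :
    ((wmax ^ 2 * Λ) •
        (∑ J : Finset (Fin m), p J •
          ∑ i ∈ J, (1 / (a i ⬝ᵥ a i)) • Matrix.vecMulVec (a i) (a i)) -
      ∑ J : Finset (Fin m), p J •
        ((∑ i ∈ J, (w i / (a i ⬝ᵥ a i)) • Matrix.vecMulVec (a i) (a i)) *
          (∑ i ∈ J, (w i / (a i ⬝ᵥ a i)) • Matrix.vecMulVec (a i) (a i)))).PosSemidef := by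
  have hc : ∀ i, 0 ≤ 1 / (a i ⬝ᵥ a i) := fun i =>
    one_div_nonneg.2 (Finset.sum_nonneg fun j _ => mul_self_nonneg _)
  rw [Finset.smul_sum, ← Finset.sum_sub_distrib]
  refine posSemidef_sum _ fun J _ => ?_
  rw [smul_comm, ← smul_sub]
  rcases (hp J).eq_or_lt with h0 | h0
  · rw [← h0, zero_smul]
    exact PosSemidef.zero
  refine PosSemidef.smul ?_ h0.le
  have hS := isHermitian_sum_smul_vecMulVec_self J (fun i => 1 / (a i ⬝ᵥ a i)) a
  have hM := isHermitian_sum_smul_vecMulVec_self J (fun i => w i / (a i ⬝ᵥ a i)) a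
  refine PosSemidef.of_dotProduct_mulVec_nonneg
    ((hS.smul (IsSelfAdjoint.all _)).sub (by
      rw [IsHermitian, conjTranspose_mul, hM.eq])) fun x => ?_
  have h := dotProduct_sq_sum_smul_vecMulVec_self_le J hc hw a hΛ0.le
    (hS.dotProduct_mulVec_le_of_spectrum_le (hΛ J h0)) x
  simp only [mul_one_div] at h
  rw [star_trivial, sub_mulVec, dotProduct_sub, smul_mulVec, dotProduct_smul, smul_eq_mul]
  linarith
end
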